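/- There do not exist positive integers m and n such that both m·n and m·(1 + m·n) are perfect squares. -/

import Mathlib

/-- There do not exist positive integers `m` and `n` such that both `m·n` and
`m·(1 + m·n)` are perfect squares. -/
theorem no_pos_int_double_square :
    ¬ ∃ m n : ℤ, 0 < m ∧ 0 < n ∧ IsSquare (m * n) ∧ IsSquare (m * (1 + m * n)) := by
  rintro ⟨m, n, hm, hn, ⟨k, hk⟩, ⟨c, hc⟩⟩
  have hmn : 0 < m * n := mul_pos hm hn
  have hco : IsCoprime (1 + m * n) m := ⟨1, -n, by ring⟩
  obtain ⟨a, ha | ha⟩ := Int.sq_of_isCoprime (c := c) hco (by linarith [hc, sq c])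
  · have h1 : |a| * |a| = 1 + |k| * |k| := by
      rw [abs_mul_abs_self, abs_mul_abs_self]; linarith [sq a]
    have hk0 : 0 < |k| := by
      apply abs_pos.mpr
      rintro rfl
      simp at hk
      omega
    have ha0 : 0 ≤ |a| := abs_nonneg a
    have h2 : |k| < |a| := by nlinarith
    nlinarith
  · nlinarith [sq_nonneg a]
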